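/- arXiv:2605.13124 — 2 statements merged into one kernel-verified Lean document; each statement's English description precedes it below -/
import Mathlib

section
/- Let X_N be a finite antipodally symmetric set of points on the unit sphere S² ⊂ ℝ³, let X_M ⊆ X_N also be antipodally symmetric, let r be a natural number, and let f : S² → ℝ satisfy f(−x) = −f(x) for all x ∈ X_N. Suppose p̂ ∈ Π_r(S²) is the unique element that satisfies p̂ = f on X_M and minimizes ∑_{x ∈ X_N} |p(x) − f(x)|² over all p ∈ Π_r(S²) satisfying p = f on X_M. Then p̂ is odd: p̂(−x) = −p̂(x) for all x ∈ S². -/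
open Finset

noncomputable section

/-- The unit sphere `S² = {x ∈ ℝ³ : ‖x‖ = 1}` (described via `∑ i, x i ^ 2 = 1`). -/
def S2 : Set (Fin 3 → ℝ) := {x | ∑ i, x i ^ 2 = 1}

/-- `PiSph r` : the space `Π_r(S²)` of restrictions to `S²` of real polynomials in
three variables of total degree at most `r` (represented by functions on `ℝ³` that
agree with such a polynomial on `S²`). -/
def PiSph (r : ℕ) : Set ((Fin 3 → ℝ) → ℝ) :=
  {p | ∃ P : MvPolynomial (Fin 3) ℝ, P.totalDegree ≤ r ∧ ∀ x ∈ S2, p x = MvPolynomial.eval x P}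

/-- Composing with `x ↦ -x` does not raise the total degree of a polynomial function. -/
theorem exists_totalDegree_le_eval_neg {σ R : Type*} [CommRing R] (P : MvPolynomial σ R) :
    ∃ Q : MvPolynomial σ R, Q.totalDegree ≤ P.totalDegree ∧
      ∀ x : σ → R, MvPolynomial.eval x Q = MvPolynomial.eval (-x) P := by
  refine ⟨∑ d ∈ P.support, MvPolynomial.monomial d ((-1) ^ (d.sum fun _ e => e) * P.coeff d),
    MvPolynomial.totalDegree_finsetSum_le fun d hd =>
      (MvPolynomial.totalDegree_monomial_le _ _).trans (MvPolynomial.le_totalDegree hd), fun x => ?_⟩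
  rw [map_sum, MvPolynomial.eval_eq (-x) P]
  refine Finset.sum_congr rfl fun d _ => ?_
  have h : ∏ i ∈ d.support, (-x) i ^ d i
      = (-1) ^ (d.sum fun _ e => e) * ∏ i ∈ d.support, x i ^ d i := by
    rw [Finsupp.sum, ← Finset.prod_pow_eq_pow_sum, ← Finset.prod_mul_distrib]
    exact Finset.prod_congr rfl fun i _ => by rw [Pi.neg_apply, neg_pow]
  rw [MvPolynomial.eval_monomial, h, Finsupp.prod]
  ring

theorem neg_mem_S2 {x : Fin 3 → ℝ} (hx : x ∈ S2) : -x ∈ S2 := by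
  simpa [S2] using hx

/-- `Π_r(S²)` is stable under the reflection `p ↦ -p(-·)`. -/
theorem neg_comp_neg_mem_PiSph {r : ℕ} {p : (Fin 3 → ℝ) → ℝ} (hp : p ∈ PiSph r) :
    (fun x => -p (-x)) ∈ PiSph r := by
  obtain ⟨P, hdeg, hP⟩ := hp
  obtain ⟨Q, hQdeg, hQ⟩ := exists_totalDegree_le_eval_neg P
  refine ⟨-Q, by rw [MvPolynomial.totalDegree_neg]; exact hQdeg.trans hdeg, fun x hx => ?_⟩
  rw [map_neg, hQ, ← hP _ (neg_mem_S2 hx)]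

/-- On an antipodally symmetric set where `f` is odd, the reflection `p ↦ -p(-·)` preserves the
sum of squared residuals. -/
theorem sum_sq_neg_comp_neg_sub {E : Type*} [InvolutiveNeg E] {s : Finset E}
    (hs : ∀ x ∈ s, -x ∈ s) {f : E → ℝ} (hf : ∀ x ∈ s, f (-x) = -f x) (p : E → ℝ) :
    ∑ x ∈ s, (-p (-x) - f x) ^ 2 = ∑ x ∈ s, (p x - f x) ^ 2 := by
  refine Finset.sum_nbij' (fun x => -x) (fun x => -x) hs hs
    (fun x _ => neg_neg x) (fun x _ => neg_neg x) fun x hx => ?_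
  rw [hf x hx]
  ring

/-- If `f` is odd on the antipodally symmetric sampling set `X_N` and `p̂` is
the unique constrained minimizer, then `p̂` is odd on `S²`. -/
theorem odd_data_gives_odd_minimizer (XN XM : Finset (Fin 3 → ℝ))
    (hXN : ↑XN ⊆ S2) (hsymN : ∀ x ∈ XN, -x ∈ XN)
    (hXM : XM ⊆ XN) (hsymM : ∀ x ∈ XM, -x ∈ XM)
    (r : ℕ) (f phat : (Fin 3 → ℝ) → ℝ)
    (hfodd : ∀ x ∈ XN, f (-x) = -f x)
    (hphat : phat ∈ PiSph r)
    (hinterp : ∀ x ∈ XM, phat x = f x)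
    (hmin : ∀ p ∈ PiSph r, (∀ x ∈ XM, p x = f x) →
      ∑ x ∈ XN, (phat x - f x) ^ 2 ≤ ∑ x ∈ XN, (p x - f x) ^ 2)
    (huniq : ∀ q ∈ PiSph r, (∀ x ∈ XM, q x = f x) →
      (∀ p ∈ PiSph r, (∀ x ∈ XM, p x = f x) →
        ∑ x ∈ XN, (q x - f x) ^ 2 ≤ ∑ x ∈ XN, (p x - f x) ^ 2) →
      ∀ x ∈ S2, q x = phat x) :
    ∀ x ∈ S2, phat (-x) = -phat x := by
  intro x hx
  have h := huniq (fun x => -phat (-x)) (neg_comp_neg_mem_PiSph hphat)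
    (fun y hy => by
      rw [hinterp _ (hsymM y hy), hfodd y (hXM hy), neg_neg])
    (fun p hp hpf => (sum_sq_neg_comp_neg_sub hsymN hfodd phat).trans_le (hmin p hp hpf)) x hx
  exact neg_eq_iff_eq_neg.mp h
end
end

section
/- Let μ be a measure on the unit sphere S² ⊂ ℝ³ with μ(S²) = 4π, let m ≤ r be natural numbers, let X_N be a finite set of N points on S², and let X_M ⊆ X_N. Let α_r > 0 be such that (1/N) ∑_{x ∈ X_N} |p(x)|² ≥ α_r ‖p‖²_{L²(μ)} for all p ∈ Π_r(S²). Let I be a linear map from continuous functions on S² to Π_m(S²) such that (I g)(x) = g(x) for all x ∈ X_M and all continuous g, and let Λ ≥ 0 be such that ‖I g‖_∞ ≤ Λ ‖g‖_∞ for all continuous g. Let f : S² → ℝ be continuous, and let p̂ ∈ Π_r(S²) satisfy p̂ = f on X_M and minimize ∑_{x ∈ X_N} |p(x) − f(x)|² over all p ∈ Π_r(S²) satisfying p = f on X_M. Then ‖f − p̂‖_{L²(μ)} ≤ (√(4π) + 1/√α_r) · (1 + Λ) · inf_{q ∈ Π_m(S²)} ‖f − q‖_∞. -/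
open Finset

noncomputable section

open MeasureTheory

/-- The uniform (sup) norm over the sphere `S²` of a function on `ℝ³`. -/
def supS2 (g : (Fin 3 → ℝ) → ℝ) : ℝ := ⨆ x : S2, |g x|

theorem isCompact_S2 : IsCompact S2 := by
  refine Metric.isCompact_of_isClosed_isBounded ?_ ?_
  · exact isClosed_eq (by fun_prop) continuous_const
  · refine Metric.isBounded_closedBall (x := (0 : Fin 3 → ℝ)) (r := 1) |>.subset ?_
    intro x hx
    rw [mem_closedBall_zero_iff, pi_norm_le_iff_of_nonneg zero_le_one]
    intro i
    rw [Real.norm_eq_abs, ← sq_le_one_iff_abs_le_one]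
    exact (Finset.single_le_sum (f := fun i => x i ^ 2) (fun j _ => sq_nonneg (x j))
      (Finset.mem_univ i)).trans_eq hx

theorem PiSph.continuousOn {r : ℕ} {p : (Fin 3 → ℝ) → ℝ} (hp : p ∈ PiSph r) :
    ContinuousOn p S2 := by
  obtain ⟨P, -, hP⟩ := hp
  exact (MvPolynomial.continuous_eval P).continuousOn.congr hP

theorem PiSph.mono {m r : ℕ} (h : m ≤ r) : PiSph m ⊆ PiSph r :=
  fun _ ⟨P, hd, hP⟩ => ⟨P, hd.trans h, hP⟩

theorem PiSph.add {r : ℕ} {p q : (Fin 3 → ℝ) → ℝ} (hp : p ∈ PiSph r) (hq : q ∈ PiSph r) :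
    p + q ∈ PiSph r := by
  obtain ⟨P, hPd, hP⟩ := hp
  obtain ⟨Q, hQd, hQ⟩ := hq
  refine ⟨P + Q, (MvPolynomial.totalDegree_add P Q).trans (max_le hPd hQd), fun x hx => ?_⟩
  simp [hP x hx, hQ x hx]

theorem PiSph.smul {r : ℕ} (c : ℝ) {p : (Fin 3 → ℝ) → ℝ} (hp : p ∈ PiSph r) :
    c • p ∈ PiSph r := by
  obtain ⟨P, hPd, hP⟩ := hp
  refine ⟨c • P, (MvPolynomial.totalDegree_smul_le c P).trans hPd, fun x hx => ?_⟩
  simp [hP x hx]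

theorem PiSph.sub {r : ℕ} {p q : (Fin 3 → ℝ) → ℝ} (hp : p ∈ PiSph r) (hq : q ∈ PiSph r) :
    p - q ∈ PiSph r := by
  have := PiSph.add hp (PiSph.smul (-1) hq)
  rwa [neg_one_smul, ← sub_eq_add_neg] at this

theorem abs_le_supS2 {g : (Fin 3 → ℝ) → ℝ} (hg : ContinuousOn g S2) {x : Fin 3 → ℝ}
    (hx : x ∈ S2) : |g x| ≤ supS2 g := by
  obtain ⟨C, hC⟩ := isCompact_S2.exists_bound_of_continuousOn hg
  exact le_ciSup (f := fun y : S2 => |g y|) ⟨C, by rintro _ ⟨y, rfl⟩; exact hC y y.2⟩ ⟨x, hx⟩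

theorem integrableOn_S2 {μ : Measure (Fin 3 → ℝ)} (hμ : μ S2 ≠ ⊤) {g : (Fin 3 → ℝ) → ℝ}
    (hg : ContinuousOn g S2) : IntegrableOn g S2 μ := by
  obtain ⟨C, hC⟩ := isCompact_S2.exists_bound_of_continuousOn hg
  have hm := isCompact_S2.measurableSet
  exact IntegrableOn.of_bound hμ.lt_top (hg.aestronglyMeasurable hm) C
    ((ae_restrict_iff' hm).2 (Filter.Eventually.of_forall hC))

/-- If `e` is shortest on the half-line from `e` in direction `d`, then `‖d‖ ≤ ‖e + d‖`. -/
theorem sum_sq_le_of_forall_sum_sq_le {ι : Type*} (s : Finset ι) (e d : ι → ℝ)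
    (h : ∀ t : ℝ, ∑ x ∈ s, e x ^ 2 ≤ ∑ x ∈ s, (e x + t * d x) ^ 2) :
    ∑ x ∈ s, d x ^ 2 ≤ ∑ x ∈ s, (e x + d x) ^ 2 := by
  have expand (t : ℝ) : ∑ x ∈ s, (e x + t * d x) ^ 2 =
      ∑ x ∈ s, e x ^ 2 + 2 * t * ∑ x ∈ s, e x * d x + t ^ 2 * ∑ x ∈ s, d x ^ 2 := by
    simp only [Finset.mul_sum, ← Finset.sum_add_distrib]
    exact Finset.sum_congr rfl fun x _ => by ring
  have h1 := expand 1
  simp only [one_mul] at h1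
  rw [h1]
  set c := ∑ x ∈ s, e x * d x
  set D := ∑ x ∈ s, d x ^ 2
  have hD : 0 ≤ D := Finset.sum_nonneg fun x _ => sq_nonneg _
  have hE : 0 ≤ ∑ x ∈ s, e x ^ 2 := Finset.sum_nonneg fun x _ => sq_nonneg _
  have hc : 0 ≤ c := by
    have ht := h (-c / (D + 1))
    rw [expand] at ht
    have key : 2 * (-c / (D + 1)) * c + (-c / (D + 1)) ^ 2 * D
        = -(c ^ 2 * (D + 2) / (D + 1) ^ 2) := by
      field_simp
      ring
    have h0 : c ^ 2 * (D + 2) / (D + 1) ^ 2 ≤ 0 := by linarith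
    have h2 : 0 ≤ c ^ 2 := sq_nonneg c
    by_contra hneg
    have : 0 < c ^ 2 := by nlinarith
    have : 0 < c ^ 2 * (D + 2) / (D + 1) ^ 2 := by positivity
    linarith
  linarith

/-- Minkowski's inequality on the sphere, for one summand bounded by `E` and one whose squared
`L²` norm is at most `E² / α`. -/
theorem sqrt_integral_add_sq_le {μ : Measure (Fin 3 → ℝ)} {V α E : ℝ} (hV : 0 < V)
    (hα : 0 < α) (hE : 0 ≤ E) (hμ : μ S2 = ENNReal.ofReal V) {a b : (Fin 3 → ℝ) → ℝ}
    (ha : ContinuousOn a S2) (hb : ContinuousOn b S2) (haE : ∀ x ∈ S2, |a x| ≤ E)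
    (hbE : α * ∫ x in S2, b x ^ 2 ∂μ ≤ E ^ 2) :
    √(∫ x in S2, (a x + b x) ^ 2 ∂μ) ≤ (√V + 1 / √α) * E := by
  have hfin : μ S2 ≠ ⊤ := by simp [hμ]
  have hm := isCompact_S2.measurableSet
  have hu : 0 < √V := Real.sqrt_pos.2 hV
  have hw : 0 < √α := Real.sqrt_pos.2 hα
  have hu2 : √V ^ 2 = V := Real.sq_sqrt hV.le
  have hw2 : √α ^ 2 = α := Real.sq_sqrt hα.le
  set u := √V
  set w := √α
  have hint_b : IntegrableOn (fun x => b x ^ 2) S2 μ := integrableOn_S2 hfin (hb.pow 2)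
  have hb2 : ∫ x in S2, b x ^ 2 ∂μ ≤ E ^ 2 / w ^ 2 := by
    rw [hw2, le_div_iff₀ hα]
    linarith
  have hconst : IntegrableOn (fun _ => (1 + 1 / (u * w)) * E ^ 2) S2 μ :=
    integrableOn_S2 hfin continuousOn_const
  have pointwise : ∀ x ∈ S2, (a x + b x) ^ 2 ≤
      (1 + 1 / (u * w)) * E ^ 2 + (1 + u * w) * b x ^ 2 := by
    intro x hx
    have h1 : a x ^ 2 ≤ E ^ 2 := sq_le_sq' (abs_le.1 (haE x hx)).1 (abs_le.1 (haE x hx)).2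
    have h2 : (1 + 1 / (u * w)) * a x ^ 2 + (1 + u * w) * b x ^ 2 - (a x + b x) ^ 2
        = (a x - u * w * b x) ^ 2 / (u * w) := by
      field_simp
      ring
    have h3 : 0 ≤ (a x - u * w * b x) ^ 2 / (u * w) := by positivity
    have h4 : (1 + 1 / (u * w)) * a x ^ 2 ≤ (1 + 1 / (u * w)) * E ^ 2 := by gcongr
    linarith
  refine Real.sqrt_le_iff.2 ⟨by positivity, ?_⟩
  calc ∫ x in S2, (a x + b x) ^ 2 ∂μ
      ≤ ∫ x in S2, ((1 + 1 / (u * w)) * E ^ 2 + (1 + u * w) * b x ^ 2) ∂μ :=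
        setIntegral_mono_on (integrableOn_S2 hfin ((ha.add hb).pow 2))
          (hconst.add (hint_b.const_mul _)) hm pointwise
    _ = V * ((1 + 1 / (u * w)) * E ^ 2) + (1 + u * w) * ∫ x in S2, b x ^ 2 ∂μ := by
        rw [integral_add hconst (hint_b.const_mul _), setIntegral_const, integral_const_mul,
          measureReal_def, hμ, ENNReal.toReal_ofReal hV.le, smul_eq_mul]
    _ ≤ u ^ 2 * ((1 + 1 / (u * w)) * E ^ 2) + (1 + u * w) * (E ^ 2 / w ^ 2) := by
        rw [hu2]
        gcongr
    _ = ((u + 1 / w) * E) ^ 2 := by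
        field_simp
        ring

/-- Quasi-optimality: assume `μ(S²) = 4π`, a discrete norming
(Marcinkiewicz–Zygmund) inequality with constant `α_r > 0` on `Π_r(S²)`, and an interpolation
operator `I` mapping continuous functions into `Π_m(S²)` (`m ≤ r`), interpolating at `X_M`,
linear on continuous functions, with uniform bound `Λ`. If `p̂ ∈ Π_r(S²)` is the constrained
minimizer for a continuous `f`, then
`‖f − p̂‖_{L²(μ)} ≤ (√(4π) + 1/√α_r)(1 + Λ)·inf_{q ∈ Π_m(S²)} ‖f − q‖_∞`. -/
theorem quasi_optimality (μ : Measure (Fin 3 → ℝ))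
    (hμ : μ S2 = ENNReal.ofReal (4 * Real.pi))
    (m r : ℕ) (hmr : m ≤ r)
    (N : ℕ) (XN XM : Finset (Fin 3 → ℝ))
    (hXN : ↑XN ⊆ S2) (hcard : XN.card = N) (hXM : XM ⊆ XN)
    (αr : ℝ) (hαr : 0 < αr)
    (hMZ : ∀ p ∈ PiSph r,
      αr * ∫ x in S2, (p x) ^ 2 ∂μ ≤ (1 / (N : ℝ)) * ∑ x ∈ XN, (p x) ^ 2)
    (I : ((Fin 3 → ℝ) → ℝ) → ((Fin 3 → ℝ) → ℝ))
    (hIadd : ∀ g h : (Fin 3 → ℝ) → ℝ, ContinuousOn g S2 → ContinuousOn h S2 →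
      ∀ x ∈ S2, I (g + h) x = I g x + I h x)
    (hIsmul : ∀ (c : ℝ) (g : (Fin 3 → ℝ) → ℝ), ContinuousOn g S2 →
      ∀ x ∈ S2, I (c • g) x = c * I g x)
    (hIrange : ∀ g : (Fin 3 → ℝ) → ℝ, ContinuousOn g S2 → I g ∈ PiSph m)
    (hIinterp : ∀ g : (Fin 3 → ℝ) → ℝ, ContinuousOn g S2 → ∀ x ∈ XM, I g x = g x)
    (Λ : ℝ) (hΛ0 : 0 ≤ Λ)
    (hΛ : ∀ g : (Fin 3 → ℝ) → ℝ, ContinuousOn g S2 → supS2 (I g) ≤ Λ * supS2 g)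
    (f : (Fin 3 → ℝ) → ℝ) (hf : ContinuousOn f S2)
    (phat : (Fin 3 → ℝ) → ℝ)
    (hphat : phat ∈ PiSph r)
    (hinterp : ∀ x ∈ XM, phat x = f x)
    (hmin : ∀ p ∈ PiSph r, (∀ x ∈ XM, p x = f x) →
      ∑ x ∈ XN, (phat x - f x) ^ 2 ≤ ∑ x ∈ XN, (p x - f x) ^ 2) :
    ∀ q ∈ PiSph m,
      Real.sqrt (∫ x in S2, (f x - phat x) ^ 2 ∂μ)
        ≤ (Real.sqrt (4 * Real.pi) + 1 / Real.sqrt αr) * (1 + Λ) *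
            supS2 (fun x => f x - q x) := by
  intro q hq
  set g : (Fin 3 → ℝ) → ℝ := fun x => f x - q x with hgdef
  have hg : ContinuousOn g S2 := hf.sub (PiSph.continuousOn hq)
  have hIg := hIrange g hg
  have hpstar : q + I g ∈ PiSph r := PiSph.mono hmr (PiSph.add hq hIg)
  set pstar := q + I g with hpdef
  have hpstar_interp : ∀ x ∈ XM, pstar x = f x := fun x hx => by
    rw [hpdef, Pi.add_apply, hIinterp g hg x hx, hgdef]
    ring
  have herr : ∀ x ∈ S2, |f x - pstar x| ≤ (1 + Λ) * supS2 g := fun x hx => by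
    have h1 := abs_le_supS2 hg hx
    have h2 := (abs_le_supS2 (PiSph.continuousOn hIg) hx).trans (hΛ g hg)
    have h3 : f x - pstar x = g x - I g x := by
      simp only [hpdef, hgdef, Pi.add_apply]
      ring
    rw [h3]
    linarith [abs_sub (g x) (I g x)]
  have hsup : 0 ≤ supS2 g := Real.iSup_nonneg fun _ => abs_nonneg _
  have hd : pstar - phat ∈ PiSph r := PiSph.sub hpstar hphat
  set E := (1 + Λ) * supS2 g with hEdef
  have hE : 0 ≤ E := by positivity
  have hsum : ∑ x ∈ XN, (pstar - phat) x ^ 2 ≤ N * E ^ 2 := by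
    refine (sum_sq_le_of_forall_sum_sq_le XN (fun x => phat x - f x) (pstar - phat)
      fun t => ?_).trans ?_
    · refine (hmin (phat + t • (pstar - phat)) (PiSph.add hphat (PiSph.smul t hd)) fun x hx => ?_).trans_eq ?_
      · simp [hinterp x hx, hpstar_interp x hx]
      · refine Finset.sum_congr rfl fun x _ => ?_
        simp only [Pi.add_apply, Pi.smul_apply, smul_eq_mul]
        ring
    · rw [← hcard, ← nsmul_eq_mul]
      refine Finset.sum_le_card_nsmul _ _ _ fun x hx => ?_
      have h1 : phat x - f x + (pstar - phat) x = -(f x - pstar x) := by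
        simp only [Pi.sub_apply]
        ring
      rw [h1, neg_sq]
      have h2 := abs_le.1 (herr x (hXN hx))
      exact sq_le_sq' h2.1 h2.2
  have hL2 : αr * ∫ x in S2, (pstar - phat) x ^ 2 ∂μ ≤ E ^ 2 := by
    refine (hMZ _ hd).trans ((mul_le_mul_of_nonneg_left hsum (by positivity)).trans ?_)
    rcases eq_or_ne (N : ℝ) 0 with hN | hN
    · rw [hN]
      simpa using sq_nonneg E
    · field_simp
      rfl
  have key := sqrt_integral_add_sq_le (by positivity) hαr hE hμ
    (hf.sub (PiSph.continuousOn hpstar)) (PiSph.continuousOn hd) herr hL2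
  rw [mul_assoc]
  simpa using key
end
end
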